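/- arXiv:1603.02367 — 2 statements merged into one kernel-verified Lean document; each statement's English description precedes it below -/
import Mathlib

section
/- Under Assumption L1, suppose P̄ is regular, i.e. P̄(u,x;t,X) = 1 for all u ∈ [T0,T1), x ∈ X, t ∈ (u,T1). If P ∈ 𝒫 takes values in [0,1], P(u,x;t,·) is a measure on (X, 𝔅(X)) for each fixed t ∈ (T0,T1), u ∈ [T0,t), x ∈ X, and P satisfies (Bi) lim_{u→t−} P(u,x;t,B) = 1_B(x) with u ↦ P(u,x;t,B) absolutely continuous on [T0,t), and (Bii) ∂/∂u P(u,x;t,B) = q(x,u)·P(u,x;t,B) − ∫_X P(u,y;t,B) q⁺(x,u,dy) for almost every u ∈ [T0,t), for all t,x,B, then P(u,x;t,B) = P̄(u,x;t,B) for all u,x,t,B. -/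
open MeasureTheory Set Filter

/-- `∫_a^b q(x,θ) dθ` (Lebesgue integral over the open interval). -/
noncomputable def qInt {X : Type*} (q : X → ℝ → ℝ) (x : X) (a b : ℝ) : ℝ :=
  ∫ θ in Set.Ioo a b, q x θ

/-- The Feller iterates `P̄⁽ⁿ⁾(u,x;t,·)`, as measures on `X`. -/
noncomputable def PbarM {X : Type*} [MeasurableSpace X]
    (q : X → ℝ → ℝ) (qp : X → ℝ → Measure X) :
    ℕ → ℝ → X → ℝ → Measure X
  | 0, u, x, t => ENNReal.ofReal (Real.exp (-(qInt q x u t))) • Measure.dirac x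
  | n + 1, u, x, t =>
      (volume.restrict (Set.Ioo u t)).bind fun w =>
        (ENNReal.ofReal (Real.exp (-(qInt q x u w))) • qp x w).bind fun y =>
          PbarM q qp n w y t

/-- `P̄(u,x;t,·) = Σ_n P̄⁽ⁿ⁾(u,x;t,·)`. -/
noncomputable def PbarMeas {X : Type*} [MeasurableSpace X]
    (q : X → ℝ → ℝ) (qp : X → ℝ → Measure X) (u : ℝ) (x : X) (t : ℝ) : Measure X :=
  Measure.sum fun n => PbarM q qp n u x t

/-- Classical (ε-δ) absolute continuity of a real function on a set. -/
def AbsContOn (f : ℝ → ℝ) (s : Set ℝ) : Prop :=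
  ∀ ε > (0:ℝ), ∃ δ > (0:ℝ), ∀ n : ℕ, ∀ a b : ℕ → ℝ,
    (∀ i < n, a i ∈ s ∧ b i ∈ s ∧ a i ≤ b i) →
    (∀ i < n, ∀ j < n, i ≠ j → Disjoint (Set.Ioo (a i) (b i)) (Set.Ioo (a j) (b j))) →
    (∑ i ∈ Finset.range n, (b i - a i)) < δ →
    (∑ i ∈ Finset.range n, |f (b i) - f (a i)|) < ε

/-- `B` is a `(q,s)`-bounded set: `q` is bounded on `B × [T0,s)`. -/
def QBddOn {X : Type*} [MeasurableSpace X] (q : X → ℝ → ℝ) (T0 : ℝ) (s : EReal)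
    (B : Set X) : Prop :=
  MeasurableSet B ∧ ∃ M : ℝ, ∀ x ∈ B, ∀ t : ℝ, T0 ≤ t → (t : EReal) < s → q x t ≤ M

/-- The interval `(u,T1)` inside `ℝ`, where `T1` may be `+∞`. -/
def IooE (u : ℝ) (T1 : EReal) : Set ℝ := {r : ℝ | u < r ∧ (r : EReal) < T1}

/-- Membership in the family `𝒫̂`. -/
def MemPhat {X : Type*} [MeasurableSpace X] (T0 : ℝ) (T1 : EReal)
    (P : ℝ → X → ℝ → Measure X) : Prop :=
  (∀ u x t, T0 ≤ u → u < t → (t : EReal) < T1 → IsFiniteMeasure (P u x t)) ∧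
  (∀ (u : ℝ) (x : X) (B : Set X), MeasurableSet B → Measurable (fun t : ℝ => P u x t B))

/-- The right-hand side of Kolmogorov's forward equation:
`−∫_B q(y,t) P(u,x;t,dy) + ∫_X q⁺(y,t,B) P(u,x;t,dy)`. -/
noncomputable def fkeRHS {X : Type*} [MeasurableSpace X]
    (q : X → ℝ → ℝ) (qp : X → ℝ → Measure X)
    (P : ℝ → X → ℝ → Measure X) (u : ℝ) (x : X) (t : ℝ) (B : Set X) : ℝ :=
  -(∫ y in B, q y t ∂(P u x t)) + ∫ y, (qp y t B).toReal ∂(P u x t)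

/-- Property (Fi): boundary condition and absolute continuity for `(q,s)`-bounded sets. -/
def FwdI {X : Type*} [MeasurableSpace X] (q : X → ℝ → ℝ) (T0 : ℝ) (T1 : EReal)
    (P : ℝ → X → ℝ → Measure X) : Prop :=
  ∀ u : ℝ, T0 ≤ u → ∀ s : ℝ, u < s → (s : EReal) < T1 → ∀ x : X, ∀ B : Set X,
    QBddOn q T0 (s : EReal) B →
    Tendsto (fun t => (P u x t B).toReal) (nhdsWithin u (Set.Ioi u))
      (nhds (Set.indicator B (fun _ => (1:ℝ)) x)) ∧
    AbsContOn (fun t => (P u x t B).toReal) (Set.Ioo u s)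

/-- Property (Fii): Kolmogorov's forward equation a.e. on `(u,s)` for `(q,s)`-bounded sets. -/
def FwdII {X : Type*} [MeasurableSpace X] (q : X → ℝ → ℝ) (qp : X → ℝ → Measure X)
    (T0 : ℝ) (T1 : EReal) (P : ℝ → X → ℝ → Measure X) : Prop :=
  ∀ u : ℝ, T0 ≤ u → ∀ s : ℝ, u < s → (s : EReal) < T1 → ∀ x : X, ∀ B : Set X,
    QBddOn q T0 (s : EReal) B →
    ∀ᵐ t ∂(volume.restrict (Set.Ioo u s)),
      HasDerivAt (fun r => (P u x r B).toReal) (fkeRHS q qp P u x t B) t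

/-- (Fi) restricted to `q`-bounded sets. -/
def FwdIQ {X : Type*} [MeasurableSpace X] (q : X → ℝ → ℝ) (T0 : ℝ) (T1 : EReal)
    (P : ℝ → X → ℝ → Measure X) : Prop :=
  ∀ u : ℝ, T0 ≤ u → ∀ s : ℝ, u < s → (s : EReal) < T1 → ∀ x : X, ∀ B : Set X,
    QBddOn q T0 T1 B →
    Tendsto (fun t => (P u x t B).toReal) (nhdsWithin u (Set.Ioi u))
      (nhds (Set.indicator B (fun _ => (1:ℝ)) x)) ∧
    AbsContOn (fun t => (P u x t B).toReal) (Set.Ioo u s)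

/-- (Fii) restricted to `q`-bounded sets. -/
def FwdIIQ {X : Type*} [MeasurableSpace X] (q : X → ℝ → ℝ) (qp : X → ℝ → Measure X)
    (T0 : ℝ) (T1 : EReal) (P : ℝ → X → ℝ → Measure X) : Prop :=
  ∀ u : ℝ, T0 ≤ u → ∀ s : ℝ, u < s → (s : EReal) < T1 → ∀ x : X, ∀ B : Set X,
    QBddOn q T0 T1 B →
    ∀ᵐ t ∂(volume.restrict (Set.Ioo u s)),
      HasDerivAt (fun r => (P u x r B).toReal) (fkeRHS q qp P u x t B) t

/-- Property (a): boundary condition and absolute continuity, `q`-bounded sets. -/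
def FwdA {X : Type*} [MeasurableSpace X] (q : X → ℝ → ℝ) (T0 : ℝ) (T1 : EReal)
    (P : ℝ → X → ℝ → Measure X) : Prop :=
  ∀ u : ℝ, T0 ≤ u → (u : EReal) < T1 → ∀ x : X, ∀ B : Set X, QBddOn q T0 T1 B →
    Tendsto (fun t => (P u x t B).toReal) (nhdsWithin u (Set.Ioi u))
      (nhds (Set.indicator B (fun _ => (1:ℝ)) x)) ∧
    ∀ s : ℝ, u < s → (s : EReal) < T1 →
      AbsContOn (fun t => (P u x t B).toReal) (Set.Ioo u s)

/-- Property (b): forward equation a.e. on the whole interval `(u,T1)`, `q`-bounded sets. -/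
def FwdB {X : Type*} [MeasurableSpace X] (q : X → ℝ → ℝ) (qp : X → ℝ → Measure X)
    (T0 : ℝ) (T1 : EReal) (P : ℝ → X → ℝ → Measure X) : Prop :=
  ∀ u : ℝ, T0 ≤ u → (u : EReal) < T1 → ∀ x : X, ∀ B : Set X, QBddOn q T0 T1 B →
    ∀ᵐ t ∂(volume.restrict (IooE u T1)),
      HasDerivAt (fun r => (P u x r B).toReal) (fkeRHS q qp P u x t B) t

/-- The integral equation (IE). -/
def IntEq {X : Type*} [MeasurableSpace X] (q : X → ℝ → ℝ) (qp : X → ℝ → Measure X)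
    (P : ℝ → X → ℝ → Measure X) (u : ℝ) (x : X) (t : ℝ) (B : Set X) : Prop :=
  P u x t B = Set.indicator B (fun _ => ENNReal.ofReal (Real.exp (-(qInt q x u t)))) x
    + ∫⁻ w in Set.Ioo u t,
        ∫⁻ z, (∫⁻ y in B, ENNReal.ofReal (Real.exp (-(qInt q y w t))) ∂(qp z w)) ∂(P u x w)

/-- The integral form (FE) of the forward equation. -/
def FEq {X : Type*} [MeasurableSpace X] (q : X → ℝ → ℝ) (qp : X → ℝ → Measure X)
    (P : ℝ → X → ℝ → Measure X) (u : ℝ) (x : X) (t : ℝ) (B : Set X) : Prop :=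
  (P u x t B).toReal = Set.indicator B (fun _ => (1:ℝ)) x
    - ∫ w in Set.Ioo u t, ∫ y in B, q y w ∂(P u x w)
    + ∫ w in Set.Ioo u t, ∫ y, (qp y w B).toReal ∂(P u x w)

/-- Property (Bi): boundary condition and absolute continuity in `u` (backward). -/
def BkwdI {X : Type*} [MeasurableSpace X] (T0 : ℝ) (T1 : EReal)
    (P : ℝ → X → ℝ → Set X → ℝ) : Prop :=
  ∀ t : ℝ, T0 < t → (t : EReal) < T1 → ∀ x : X, ∀ B : Set X, MeasurableSet B →
    Tendsto (fun u => P u x t B) (nhdsWithin t (Set.Iio t))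
      (nhds (Set.indicator B (fun _ => (1:ℝ)) x)) ∧
    AbsContOn (fun u => P u x t B) (Set.Ico T0 t)

/-- Property (Bii): Kolmogorov's backward equation a.e. on `[T0,t)`. -/
def BkwdII {X : Type*} [MeasurableSpace X] (q : X → ℝ → ℝ) (qp : X → ℝ → Measure X)
    (T0 : ℝ) (T1 : EReal) (P : ℝ → X → ℝ → Set X → ℝ) : Prop :=
  ∀ t : ℝ, T0 < t → (t : EReal) < T1 → ∀ x : X, ∀ B : Set X, MeasurableSet B →
    ∀ᵐ u ∂(volume.restrict (Set.Ico T0 t)),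
      HasDerivAt (fun v => P v x t B)
        (q x u * P u x t B - ∫ y, P u y t B ∂(qp x u)) u

/-- (FE) for all `q`-bounded sets and all `t ∈ (u,T1)`. -/
def FEqAll {X : Type*} [MeasurableSpace X] (q : X → ℝ → ℝ) (qp : X → ℝ → Measure X)
    (T0 : ℝ) (T1 : EReal) (P : ℝ → X → ℝ → Measure X) : Prop :=
  ∀ u : ℝ, T0 ≤ u → ∀ x : X, ∀ B : Set X, QBddOn q T0 T1 B →
    ∀ t : ℝ, u < t → (t : EReal) < T1 → FEq q qp P u x t B

/-- (FE) for all `(q,s)`-bounded sets and all `t ∈ (u,s)`. -/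
def FEqAllS {X : Type*} [MeasurableSpace X] (q : X → ℝ → ℝ) (qp : X → ℝ → Measure X)
    (T0 : ℝ) (T1 : EReal) (P : ℝ → X → ℝ → Measure X) : Prop :=
  ∀ u : ℝ, T0 ≤ u → ∀ s : ℝ, u < s → (s : EReal) < T1 → ∀ x : X, ∀ B : Set X,
    QBddOn q T0 (s : EReal) B → ∀ t : ℝ, u < t → t < s → FEq q qp P u x t B

/-- (IE) for all measurable sets and all `u ∈ [T0,T1)`, `t ∈ (u,T1)`. -/
def IntEqAll {X : Type*} [MeasurableSpace X] (q : X → ℝ → ℝ) (qp : X → ℝ → Measure X)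
    (T0 : ℝ) (T1 : EReal) (P : ℝ → X → ℝ → Measure X) : Prop :=
  ∀ u : ℝ, T0 ≤ u → ∀ t : ℝ, u < t → (t : EReal) < T1 → ∀ x : X, ∀ B : Set X,
    MeasurableSet B → IntEq q qp P u x t B

lemma AbsContOn.absolutelyContinuousOnInterval {f : ℝ → ℝ} {s : Set ℝ} (hf : AbsContOn f s)
    {a b : ℝ} (hab : uIcc a b ⊆ s) : AbsolutelyContinuousOnInterval f a b := by
  rw [absolutelyContinuousOnInterval_iff]
  intro ε hε
  obtain ⟨δ, hδ, H⟩ := hf ε hε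
  refine ⟨δ, hδ, ?_⟩
  rintro ⟨n, I⟩ ⟨hmem, hdisj⟩ hsum
  have key := H n (fun i => min (I i).1 (I i).2) (fun i => max (I i).1 (I i).2) ?_ ?_ ?_
  · refine lt_of_le_of_lt (le_of_eq (Finset.sum_congr rfl fun i _ => ?_)) key
    rcases le_total (I i).1 (I i).2 with h | h
    · simp [h, Real.dist_eq, abs_sub_comm]
    · simp [h, Real.dist_eq]
  · intro i hi
    have := hmem i (Finset.mem_range.2 hi)
    rcases le_total (I i).1 (I i).2 with h | h
    · simpa [h] using ⟨hab this.1, hab this.2⟩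
    · simpa [h] using ⟨hab this.2, hab this.1⟩
  · intro i hi j hj hij
    exact (hdisj (by simpa using hi) (by simpa using hj) hij).mono Ioo_subset_Ioc_self
      Ioo_subset_Ioc_self
  · refine lt_of_le_of_lt (le_of_eq (Finset.sum_congr rfl fun i _ => ?_)) hsum
    rw [max_sub_min_eq_abs', Real.dist_eq]

lemma LipschitzOnWith.comp_absolutelyContinuousOnInterval {f g : ℝ → ℝ} {K : NNReal} {s : Set ℝ}
    {a b : ℝ} (hg : LipschitzOnWith K g s) (hf : AbsolutelyContinuousOnInterval f a b)
    (hs : ∀ x ∈ uIcc a b, f x ∈ s) :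
    AbsolutelyContinuousOnInterval (fun x => g (f x)) a b := by
  have hK := Tendsto.const_mul (K : ℝ) hf
  rw [mul_zero] at hK
  refine squeeze_zero' (Eventually.of_forall fun E => Finset.sum_nonneg fun i _ => dist_nonneg)
    ?_ hK
  filter_upwards [mem_inf_of_right (mem_principal_self _)] with E hE
  rw [Finset.mul_sum]
  exact Finset.sum_le_sum fun i hi =>
    hg.dist_le_mul _ (hs _ (hE.1 i hi).1) _ (hs _ (hE.1 i hi).2)

lemma lipschitzOnWith_exp_neg_Ici : LipschitzOnWith 1 (fun x : ℝ => Real.exp (-x)) (Ici 0) := by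
  refine Convex.lipschitzOnWith_of_nnnorm_deriv_le (𝕜 := ℝ) (fun x _ => by fun_prop)
    (fun x hx => ?_) (convex_Ici 0)
  have : deriv (fun x : ℝ => Real.exp (-x)) x = -Real.exp (-x) := by
    simpa using ((hasDerivAt_id x).neg.exp).deriv
  rw [this, nnnorm_neg, ← NNReal.coe_le_coe, coe_nnnorm, Real.norm_eq_abs, Real.abs_exp]
  simpa using hx

/-- Integrating factor form of the linear equation `h' = r h - F` with terminal value `L`. -/
lemma ofReal_mul_exp_add_lintegral_le {u t L : ℝ} (hut : u < t) {r h : ℝ → ℝ} {F : ℝ → ENNReal}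
    (hr : IntervalIntegrable r volume u t) (hr0 : ∀ w ∈ Ioo u t, 0 ≤ r w)
    (hh0 : ∀ w ∈ Ico u t, 0 ≤ h w)
    (hac : ∀ s ∈ Ioo u t, AbsolutelyContinuousOnInterval h u s)
    (hL : Tendsto h (nhdsWithin t (Iio t)) (nhds L))
    (hF : ∀ w ∈ Ioo u t, F w ≠ ⊤)
    (hderiv : ∀ᵐ w, w ∈ Ioo u t → HasDerivAt h (r w * h w - (F w).toReal) w) :
    ENNReal.ofReal (Real.exp (-∫ θ in u..t, r θ) * L)
      + ∫⁻ w in Ioo u t, ENNReal.ofReal (Real.exp (-∫ θ in u..w, r θ)) * F w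
      ≤ ENNReal.ofReal (h u) := by
  set Q : ℝ → ℝ := fun w => ∫ θ in u..w, r θ with hQ
  set e : ℝ → ℝ := fun w => Real.exp (-Q w) with he
  set G : ℝ → ENNReal := fun w => ENNReal.ofReal (e w) * F w with hG
  have hQac : AbsolutelyContinuousOnInterval Q u t :=
    hr.absolutelyContinuousOnInterval_intervalIntegral left_mem_uIcc
  have hQ0 : ∀ w ∈ uIcc u t, Q w ∈ Ici (0 : ℝ) := by
    intro w hw
    rw [uIcc_of_le hut.le] at hw
    have : ∀ᵐ θ ∂volume.restrict (Ioc u w), 0 ≤ r θ := by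
      rw [← restrict_Ioo_eq_restrict_Ioc]
      filter_upwards [ae_restrict_mem measurableSet_Ioo] with θ hθ
      exact hr0 θ ⟨hθ.1, hθ.2.trans_le hw.2⟩
    simp only [mem_Ici, hQ, intervalIntegral.integral_of_le hw.1]
    exact integral_nonneg_of_ae this
  have heac : AbsolutelyContinuousOnInterval e u t :=
    lipschitzOnWith_exp_neg_Ici.comp_absolutelyContinuousOnInterval hQac hQ0
  have hederiv : ∀ᵐ w, w ∈ Ioo u t → HasDerivAt e (-r w * e w) w := by
    filter_upwards [hr.ae_hasDerivAt_integral] with w hw hwm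
    have hmem : w ∈ uIcc u t := by
      rw [uIcc_of_le hut.le]; exact Ioo_subset_Icc_self hwm
    simpa [he, hQ, mul_comm] using (hw hmem u left_mem_uIcc).neg.exp
  have hstep : ∀ s ∈ Ioo u t,
      ENNReal.ofReal (e s * h s) + ∫⁻ w in Ioo u s, G w = ENNReal.ofReal (h u) := by
    intro s hs
    have hsub : uIcc u s ⊆ uIcc u t := by
      rw [uIcc_of_le hs.1.le, uIcc_of_le hut.le]; exact Icc_subset_Icc_right hs.2.le
    have hg := (heac.mono hsub).fun_mul (hac s hs)
    have hftc := hg.integral_deriv_eq_sub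
    have hint := hg.intervalIntegrable_deriv
    rw [intervalIntegrable_iff_integrableOn_Ioo_of_le hs.1.le] at hint
    rw [intervalIntegral.integral_of_le hs.1.le, integral_Ioc_eq_integral_Ioo] at hftc
    have hd : ∀ᵐ w ∂volume.restrict (Ioo u s),
        -deriv (fun w => e w * h w) w = e w * (F w).toReal := by
      rw [ae_restrict_iff' measurableSet_Ioo]
      filter_upwards [hederiv, hderiv] with w h1 h2 hw
      have hw' : w ∈ Ioo u t := ⟨hw.1, hw.2.trans hs.2⟩
      rw [((h1 hw').fun_mul (h2 hw')).deriv]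
      ring
    have hlint : ∫⁻ w in Ioo u s, G w
        = ENNReal.ofReal (∫ w in Ioo u s, -deriv (fun w => e w * h w) w) := by
      rw [ofReal_integral_eq_lintegral_ofReal hint.fun_neg]
      · refine lintegral_congr_ae ?_
        filter_upwards [hd, ae_restrict_mem measurableSet_Ioo] with w hw hwm
        have hFw := hF w ⟨hwm.1, hwm.2.trans hs.2⟩
        rw [hw, ENNReal.ofReal_mul (Real.exp_pos _).le, ENNReal.ofReal_toReal hFw]
      · filter_upwards [hd] with w hw
        rw [Pi.zero_apply, hw]
        positivity
    have heu : e u = 1 := by simp [he, hQ]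
    rw [hlint, ← ENNReal.ofReal_add]
    · rw [integral_neg, hftc, heu]
      congr 1; ring
    · exact mul_nonneg (Real.exp_pos _).le (hh0 s ⟨hs.1.le, hs.2⟩)
    · refine integral_nonneg_of_ae ?_
      filter_upwards [hd] with w hw
      rw [Pi.zero_apply, hw]
      positivity
  obtain ⟨σ, hσmono, hσmem, hσlim⟩ := exists_seq_strictMono_tendsto' hut
  have hunion : Ioo u t = ⋃ n, Ioo u (σ n) := by
    ext w
    simp only [mem_iUnion, mem_Ioo]
    constructor
    · rintro ⟨h1, h2⟩
      obtain ⟨n, hn⟩ := (hσlim.eventually_const_lt h2).exists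
      exact ⟨n, h1, hn⟩
    · rintro ⟨n, h1, h2⟩
      exact ⟨h1, h2.trans (hσmem n).2⟩
  have hmono : Monotone fun n => Ioo u (σ n) := fun m n hmn =>
    Ioo_subset_Ioo_right (hσmono.monotone hmn)
  have hA : Tendsto (fun n => ∫⁻ w in Ioo u (σ n), G w) atTop (nhds (∫⁻ w in Ioo u t, G w)) := by
    rw [hunion, setLIntegral_iUnion_of_directed _ hmono.directed_le]
    exact tendsto_atTop_iSup fun m n hmn => lintegral_mono_set (hmono hmn)
  have hσw : Tendsto σ atTop (nhdsWithin t (Iio t)) :=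
    tendsto_nhdsWithin_iff.2 ⟨hσlim, Eventually.of_forall fun n => (hσmem n).2⟩
  have het : Tendsto (fun n => e (σ n)) atTop (nhds (e t)) := by
    have hc := heac.continuousOn t right_mem_uIcc
    refine hc.tendsto.comp (tendsto_nhdsWithin_iff.2 ⟨hσlim, Eventually.of_forall fun n => ?_⟩)
    rw [uIcc_of_le hut.le]
    exact Ioo_subset_Icc_self (hσmem n)
  have hlim := (ENNReal.tendsto_ofReal (het.mul (hL.comp hσw))).add hA
  exact le_of_tendsto' hlim fun n => (hstep _ (hσmem n)).le

lemma sum_lintegral_le_lintegral_sum {α : Type*} [MeasurableSpace α] (μ : Measure α) (n : ℕ)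
    (f : ℕ → α → ENNReal) :
    ∑ k ∈ Finset.range n, ∫⁻ a, f k a ∂μ ≤ ∫⁻ a, ∑ k ∈ Finset.range n, f k a ∂μ := by
  induction n with
  | zero => simp
  | succ n ih =>
    simp only [Finset.sum_range_succ]
    exact (add_le_add_left ih _).trans (le_lintegral_add _ _)

lemma PbarM_succ_apply_le {X : Type*} [MeasurableSpace X] (q : X → ℝ → ℝ) (qp : X → ℝ → Measure X)
    (n : ℕ) (u : ℝ) (x : X) (t : ℝ) {B : Set X} (hB : MeasurableSet B) :
    PbarM q qp (n + 1) u x t B ≤ ∫⁻ w in Ioo u t,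
      ENNReal.ofReal (Real.exp (-(qInt q x u w))) * ∫⁻ y, PbarM q qp n w y t B ∂(qp x w) := by
  rw [PbarM]
  refine (Measure.bind_apply_le _ hB).trans (lintegral_mono fun w => ?_)
  refine (Measure.bind_apply_le _ hB).trans (le_of_eq ?_)
  rw [lintegral_smul_measure, smul_eq_mul]

/-- The Feller iterates are dominated by every supersolution of the integrated backward equation. -/
lemma PbarMeas_apply_le_of_supersolution {X : Type*} [MeasurableSpace X] {q : X → ℝ → ℝ}
    {qp : X → ℝ → Measure X} {T0 t : ℝ} {B : Set X} (hB : MeasurableSet B)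
    {g : ℝ → X → ENNReal}
    (hg : ∀ u x, T0 ≤ u → u < t →
      PbarM q qp 0 u x t B + ∫⁻ w in Ioo u t,
        ENNReal.ofReal (Real.exp (-(qInt q x u w))) * ∫⁻ y, g w y ∂(qp x w) ≤ g u x)
    {u : ℝ} (hu : T0 ≤ u) (hut : u < t) (x : X) :
    PbarMeas q qp u x t B ≤ g u x := by
  have key : ∀ n u x, T0 ≤ u → u < t →
      ∑ k ∈ Finset.range n, PbarM q qp k u x t B ≤ g u x := by
    intro n
    induction n with
    | zero => simp
    | succ n ih =>
      intro u x hu hut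
      rw [Finset.sum_range_succ', add_comm]
      refine le_trans (add_le_add_right ?_ _) (hg u x hu hut)
      refine (Finset.sum_le_sum fun k _ => PbarM_succ_apply_le q qp k u x t hB).trans ?_
      refine (sum_lintegral_le_lintegral_sum _ n _).trans ?_
      refine setLIntegral_mono' measurableSet_Ioo fun w hw => ?_
      rw [← Finset.mul_sum]
      gcongr
      refine (sum_lintegral_le_lintegral_sum _ n _).trans (lintegral_mono fun y => ?_)
      exact ih w y (hu.trans hw.1.le) hw.2
  rw [PbarMeas, Measure.sum_apply _ hB, ENNReal.tsum_eq_iSup_nat]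
  exact iSup_le fun n => key n u x hu hut

theorem pbar_unique_backward_of_regular
    {X : Type*} [MeasurableSpace X] [StandardBorelSpace X]
    (T0 : ℝ) (T1 : EReal) (hT0 : 0 ≤ T0) (hT01 : (T0 : EReal) < T1)
    (q : X → ℝ → ℝ) (qp : X → ℝ → Measure X)
    (hq_nonneg : ∀ x t, T0 ≤ t → (t : EReal) < T1 → 0 ≤ q x t)
    (hq_meas : Measurable (Function.uncurry q))
    (hqp_self : ∀ x t, T0 ≤ t → (t : EReal) < T1 → qp x t {x} = 0)
    (hqp_total : ∀ x t, T0 ≤ t → (t : EReal) < T1 → qp x t Set.univ = ENNReal.ofReal (q x t))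
    (hqp_meas : ∀ B : Set X, MeasurableSet B → Measurable (fun p : X × ℝ => qp p.1 p.2 B))
    (hL1 : ∀ x : X, ∀ s : ℝ, T0 < s → (s : EReal) < T1 →
      ∫⁻ t in Set.Ioo T0 s, ENNReal.ofReal (q x t) < ⊤)
    (hreg : ∀ (u : ℝ) (x : X) (t : ℝ), T0 ≤ u → u < t → (t : EReal) < T1 →
      PbarMeas q qp u x t Set.univ = 1)
    (P : ℝ → X → ℝ → Measure X)
    (hP_le : ∀ (u : ℝ) (x : X) (t : ℝ) (B : Set X), T0 ≤ u → u < t → (t : EReal) < T1 →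
      MeasurableSet B → P u x t B ≤ 1)
    (hP_meas : ∀ (t : ℝ) (B : Set X), MeasurableSet B →
      Measurable (fun p : ℝ × X => (P p.1 p.2 t B).toReal))
    (hBi : BkwdI T0 T1 (fun u x t B => (P u x t B).toReal))
    (hBii : BkwdII q qp T0 T1 (fun u x t B => (P u x t B).toReal))
    :
    ∀ (u : ℝ) (x : X) (t : ℝ) (B : Set X), T0 ≤ u → u < t → (t : EReal) < T1 →
      MeasurableSet B → P u x t B = PbarMeas q qp u x t B := by
  intro u x t B hu hut ht hB
  have hsuper : ∀ B : Set X, MeasurableSet B → PbarMeas q qp u x t B ≤ P u x t B := by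
    intro B hB
    refine PbarMeas_apply_le_of_supersolution (T0 := T0) (g := fun u x => P u x t B) hB ?_ hu hut x
    intro u x hu hut
    have hT0t : T0 < t := hu.trans_lt hut
    have hlt : ∀ w, w < t → (w : EReal) < T1 := fun w hw => (EReal.coe_lt_coe_iff.2 hw).trans ht
    have hfin : ∀ w y, T0 ≤ w → w < t → P w y t B ≠ ⊤ := fun w y h1 h2 =>
      ((hP_le w y t B h1 h2 ht hB).trans_lt ENNReal.one_lt_top).ne
    have hqInt : ∀ w, u ≤ w → qInt q x u w = ∫ θ in u..w, q x θ := fun w hw => by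
      rw [qInt, intervalIntegral.integral_of_le hw, integral_Ioc_eq_integral_Ioo]
    have hqx : Measurable (q x) := hq_meas.of_uncurry_left
    have hqi : IntervalIntegrable (q x) volume u t := by
      rw [intervalIntegrable_iff_integrableOn_Ioo_of_le hut.le]
      refine IntegrableOn.mono_set (t := Ioo T0 t) ?_ (Ioo_subset_Ioo_left hu)
      refine ⟨hqx.aestronglyMeasurable, ?_⟩
      rw [hasFiniteIntegral_iff_ofReal]
      · exact hL1 x t hT0t ht
      · filter_upwards [ae_restrict_mem measurableSet_Ioo] with θ hθ
        exact hq_nonneg x θ hθ.1.le (hlt θ hθ.2)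
    obtain ⟨hlim, hac⟩ := hBi t hT0t ht x B hB
    have hFle : ∀ w ∈ Ioo u t, ∫⁻ y, P w y t B ∂(qp x w) ≠ ⊤ := fun w hw => by
      have hw0 := hu.trans hw.1.le
      have hle : ∫⁻ y, P w y t B ∂(qp x w) ≤ ∫⁻ _, 1 ∂(qp x w) :=
        lintegral_mono fun y => hP_le w y t B hw0 hw.2 ht hB
      rw [lintegral_one, hqp_total x w hw0 (hlt w hw.2)] at hle
      exact (hle.trans_lt ENNReal.ofReal_lt_top).ne
    have hderiv : ∀ᵐ w, w ∈ Ioo u t → HasDerivAt (fun v => (P v x t B).toReal)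
        (q x w * (P w x t B).toReal - (∫⁻ y, P w y t B ∂(qp x w)).toReal) w := by
      have h := hBii t hT0t ht x B hB
      rw [ae_restrict_iff' measurableSet_Ico] at h
      filter_upwards [h] with w hw hwm
      have hw0 := hu.trans hwm.1.le
      have hmeas : Measurable fun y => (P w y t B).toReal :=
        (hP_meas t B hB).comp measurable_prodMk_left
      have hint : ∫ y, (P w y t B).toReal ∂(qp x w) = (∫⁻ y, P w y t B ∂(qp x w)).toReal := by
        rw [integral_eq_lintegral_of_nonneg_ae (Eventually.of_forall fun _ => ENNReal.toReal_nonneg)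
          hmeas.aestronglyMeasurable]
        simp only [ENNReal.ofReal_toReal (hfin w _ hw0 hwm.2)]
      rw [← hint]
      exact hw ⟨hw0, hwm.2⟩
    have hmain := ofReal_mul_exp_add_lintegral_le hut hqi
      (fun w hw => hq_nonneg x w (hu.trans hw.1.le) (hlt w hw.2))
      (fun w _ => ENNReal.toReal_nonneg)
      (fun s hs => hac.absolutelyContinuousOnInterval (by
        rw [uIcc_of_le hs.1.le]
        exact fun w hw => ⟨hu.trans hw.1, hw.2.trans_lt hs.2⟩))
      hlim hFle hderiv
    rw [ENNReal.ofReal_toReal (hfin u x hu hut)] at hmain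
    refine le_trans (le_of_eq ?_) hmain
    congr 1
    · rw [PbarM, Measure.smul_apply, Measure.dirac_apply' _ hB, hqInt t hut.le, smul_eq_mul,
        ENNReal.ofReal_mul (Real.exp_pos _).le]
      by_cases hx : x ∈ B <;> simp [hx]
    · refine setLIntegral_congr_fun measurableSet_Ioo fun w hw => ?_
      rw [hqInt w hw.1.le]
  have hreg' := hreg u x t hu hut ht
  have hsum := measure_add_measure_compl (μ := PbarMeas q qp u x t) hB
  have hsumP := measure_add_measure_compl (μ := P u x t) hB
  have hcompl := hsuper Bᶜ hB.compl
  have hcfin : PbarMeas q qp u x t Bᶜ ≠ ⊤ :=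
    ((measure_mono (subset_univ _)).trans_lt (hreg'.trans_lt ENNReal.one_lt_top)).ne
  refine le_antisymm ?_ (hsuper B hB)
  refine (ENNReal.add_le_add_iff_right hcfin).1 ?_
  calc P u x t B + PbarMeas q qp u x t Bᶜ ≤ P u x t B + P u x t Bᶜ := by gcongr
    _ = P u x t univ := hsumP
    _ ≤ 1 := hP_le u x t univ hu hut ht MeasurableSet.univ
    _ = PbarMeas q qp u x t B + PbarMeas q qp u x t Bᶜ := by rw [hsum, hreg']
end

section
/- Under Assumption ALB, for all u ∈ [T0,T1), s ∈ (u,T1), x ∈ X, and every (q,s)-bounded set B ⊆ X, Kolmogorov's forward equation ∂/∂t P̄(u,x;t,B) = −∫_B q(y,t) P̄(u,x;t,dy) + ∫_X q⁺(y,t,B) P̄(u,x;t,dy) holds for almost every t ∈ (u,s). -/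
open MeasureTheory Set Filter

open ProbabilityTheory
open scoped ENNReal

/-- The probability of not jumping during `(u,t)` when started from `x`. -/
noncomputable def survival {X : Type*} (q : X → ℝ → ℝ) (x : X) (u t : ℝ) : ℝ≥0∞ :=
  ENNReal.ofReal (Real.exp (-(qInt q x u t)))

/-- A conservative Q-function on the whole time axis, bounded in time for each state. -/
structure IsBoundedQFunction {X : Type*} [MeasurableSpace X]
    (q : X → ℝ → ℝ) (qp : X → ℝ → Measure X) : Prop where
  nonneg : ∀ x t, 0 ≤ q x t
  measurable_rate : Measurable (Function.uncurry q)
  measurable_jump : ∀ B, MeasurableSet B → Measurable fun p : X × ℝ => qp p.1 p.2 B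
  jump_univ : ∀ x t, qp x t univ = ENNReal.ofReal (q x t)
  bounded : ∀ x, ∃ M : ℝ, ∀ t, q x t ≤ M

theorem measurable_setLIntegral_Ioo {α : Type*} [MeasurableSpace α] {f : α → ℝ → ℝ≥0∞}
    (hf : Measurable (Function.uncurry f)) {a b : α → ℝ} (ha : Measurable a) (hb : Measurable b) :
    Measurable fun z => ∫⁻ w in Ioo (a z) (b z), f z w := by
  have hS : MeasurableSet {p : α × ℝ | a p.1 < p.2 ∧ p.2 < b p.1} :=
    (measurableSet_lt (ha.comp measurable_fst) measurable_snd).inter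
      (measurableSet_lt measurable_snd (hb.comp measurable_fst))
  refine (congrArg Measurable ?_).mp ((hf.indicator hS).lintegral_prod_right' (ν := volume))
  funext z
  rw [← lintegral_indicator measurableSet_Ioo]
  rfl

theorem measurable_setIntegral_Ioo {α : Type*} [MeasurableSpace α] {f : α → ℝ → ℝ}
    (hf : Measurable (Function.uncurry f)) {a b : α → ℝ} (ha : Measurable a) (hb : Measurable b) :
    Measurable fun z => ∫ w in Ioo (a z) (b z), f z w := by
  have hS : MeasurableSet {p : α × ℝ | a p.1 < p.2 ∧ p.2 < b p.1} :=
    (measurableSet_lt (ha.comp measurable_fst) measurable_snd).inter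
      (measurableSet_lt measurable_snd (hb.comp measurable_fst))
  have := ((hf.indicator hS).stronglyMeasurable.integral_prod_right' (ν := volume)).measurable
  refine (congrArg Measurable ?_).mp this
  funext z
  rw [← integral_indicator measurableSet_Ioo]
  rfl

theorem lintegral_Ioo_triangle_swap {F : ℝ → ℝ → ℝ≥0∞} (hF : Measurable (Function.uncurry F))
    (u t : ℝ) :
    ∫⁻ w in Ioo u t, ∫⁻ v in Ioo u w, F v w = ∫⁻ v in Ioo u t, ∫⁻ w in Ioo v t, F v w := by
  have hS : MeasurableSet {p : ℝ × ℝ | u < p.1 ∧ p.1 < p.2 ∧ p.2 < t} :=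
    (measurableSet_lt measurable_const measurable_fst).inter
      ((measurableSet_lt measurable_fst measurable_snd).inter
        (measurableSet_lt measurable_snd measurable_const))
  have hG := hF.indicator hS
  have := lintegral_lintegral_swap (μ := (volume : Measure ℝ)) (ν := (volume : Measure ℝ))
    (f := fun v w => {p : ℝ × ℝ | u < p.1 ∧ p.1 < p.2 ∧ p.2 < t}.indicator
      (Function.uncurry F) (v, w)) hG.aemeasurable
  rw [← lintegral_indicator measurableSet_Ioo, ← lintegral_indicator measurableSet_Ioo]
  refine Eq.trans ?_ (this.symm.trans ?_) <;> congr 1 <;> funext r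
  · by_cases hr : r ∈ Ioo u t
    · rw [indicator_of_mem hr, ← lintegral_indicator measurableSet_Ioo]
      congr 1; funext v
      simp only [indicator, mem_Ioo, mem_ofPred_eq, Function.uncurry]
      grind
    · rw [indicator_of_notMem hr]
      refine (lintegral_eq_zero_of_ae_eq_zero (.of_forall fun v => ?_)).symm
      simp only [indicator, mem_Ioo, mem_ofPred_eq, Pi.zero_apply, ite_eq_right_iff] at hr ⊢
      grind
  · by_cases hr : r ∈ Ioo u t
    · rw [indicator_of_mem hr, ← lintegral_indicator measurableSet_Ioo]
      congr 1; funext v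
      simp only [indicator, mem_Ioo, mem_ofPred_eq, Function.uncurry] at hr ⊢
      grind
    · rw [indicator_of_notMem hr]
      refine lintegral_eq_zero_of_ae_eq_zero (.of_forall fun v => ?_)
      simp only [indicator, mem_Ioo, mem_ofPred_eq, Pi.zero_apply, ite_eq_right_iff] at hr ⊢
      grind

theorem abs_exp_neg_sub_exp_neg_le {a b : ℝ} (ha : 0 ≤ a) (hb : 0 ≤ b) :
    |Real.exp (-a) - Real.exp (-b)| ≤ |a - b| := by
  wlog hab : a ≤ b generalizing a b
  · rw [abs_sub_comm, abs_sub_comm a]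
    exact this hb ha (le_of_not_ge hab)
  have h1 : Real.exp (-b) ≤ Real.exp (-a) := Real.exp_le_exp.2 (by linarith)
  have h2 : Real.exp (-b) = Real.exp (-a) * Real.exp (-(b - a)) := by
    rw [← Real.exp_add]; ring_nf
  have h3 := Real.add_one_le_exp (-(b - a))
  have h4 : Real.exp (-a) ≤ 1 := Real.exp_le_one_iff.2 (by linarith)
  have h5 := Real.exp_pos (-a)
  rw [abs_of_nonneg (by linarith), abs_of_nonpos (by linarith), h2]
  nlinarith

theorem exp_neg_integral_add_integral {f : ℝ → ℝ} (hf : Measurable f) (h0 : ∀ w, 0 ≤ f w) {M : ℝ}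
    (hM : ∀ w, f w ≤ M) {u t : ℝ} (hut : u ≤ t) :
    Real.exp (-∫ θ in u..t, f θ) + ∫ w in u..t, Real.exp (-∫ θ in u..w, f θ) * f w = 1 := by
  have hM0 : 0 ≤ M := (h0 0).trans (hM 0)
  have hint (a b : ℝ) : IntervalIntegrable f volume a b :=
    (intervalIntegrable_const (c := M)).mono_fun hf.aestronglyMeasurable
      (.of_forall fun w => by
        simpa [abs_of_nonneg (h0 w), abs_of_nonneg hM0] using hM w)
  have hlip : LipschitzOnWith M.toNNReal (fun w => Real.exp (-∫ θ in u..w, f θ)) (uIcc u t) := by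
    refine LipschitzOnWith.of_dist_le_mul fun a ha b hb => ?_
    rw [uIcc_of_le hut] at ha hb
    rw [Real.dist_eq, Real.dist_eq, Real.coe_toNNReal _ hM0]
    refine (abs_exp_neg_sub_exp_neg_le
      (intervalIntegral.integral_nonneg_of_forall ha.1 h0)
      (intervalIntegral.integral_nonneg_of_forall hb.1 h0)).trans ?_
    rw [intervalIntegral.integral_interval_sub_left (hint _ _) (hint _ _)]
    refine intervalIntegral.norm_integral_le_of_norm_le_const (E := ℝ) fun w _ => ?_
    simpa [abs_of_nonneg (h0 w)] using hM w
  have hac := hlip.absolutelyContinuousOnInterval.integral_deriv_eq_sub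
  have hcongr : ∫ w in u..t, deriv (fun w => Real.exp (-∫ θ in u..w, f θ)) w =
      ∫ w in u..t, -(Real.exp (-∫ θ in u..w, f θ) * f w) := by
    refine intervalIntegral.integral_congr_ae ?_
    filter_upwards [(hint u t).ae_hasDerivAt_integral] with w hw hwm
    have := ((hw (uIoc_subset_uIcc hwm) u left_mem_uIcc).fun_neg.exp).deriv
    rw [this]; ring
  rw [hcongr, intervalIntegral.integral_neg] at hac
  simp only [intervalIntegral.integral_same, neg_zero, Real.exp_zero] at hac
  linarith

theorem IsBoundedQFunction.survival_add_lintegral {X : Type*} [MeasurableSpace X]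
    {q : X → ℝ → ℝ} {qp : X → ℝ → Measure X} (h : IsBoundedQFunction q qp) (x : X) {u t : ℝ}
    (hut : u ≤ t) :
    survival q x u t + ∫⁻ w in Ioo u t, survival q x u w * ENNReal.ofReal (q x w) = 1 := by
  obtain ⟨M, hM⟩ := h.bounded x
  have hq : Measurable (q x) := h.measurable_rate.comp measurable_prodMk_left
  have hI (w : ℝ) (hw : u ≤ w) : qInt q x u w = ∫ θ in u..w, q x θ := by
    rw [intervalIntegral.integral_of_le hw, integral_Ioc_eq_integral_Ioo]; rfl
  have key := exp_neg_integral_add_integral hq (h.nonneg x) hM hut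
  have hnn (w : ℝ) : 0 ≤ Real.exp (-(qInt q x u w)) * q x w :=
    mul_nonneg (Real.exp_pos _).le (h.nonneg x w)
  have hmeas : Measurable fun w => Real.exp (-(qInt q x u w)) * q x w := by
    refine Measurable.mul (Measurable.exp (Measurable.neg ?_)) hq
    exact measurable_setIntegral_Ioo (f := fun _ θ => q x θ) (hq.comp measurable_snd)
      measurable_const measurable_id
  have hI0 (w : ℝ) : 0 ≤ qInt q x u w := integral_nonneg fun θ => h.nonneg x θ
  have hM0 : 0 ≤ M := (h.nonneg x 0).trans (hM 0)
  have hintg : IntegrableOn (fun w => Real.exp (-(qInt q x u w)) * q x w) (Ioo u t) := by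
    refine Integrable.mono' (integrable_const M) hmeas.aestronglyMeasurable (.of_forall fun w => ?_)
    rw [Real.norm_of_nonneg (hnn w)]
    have : Real.exp (-(qInt q x u w)) ≤ 1 := Real.exp_le_one_iff.2 (by linarith [hI0 w])
    exact (mul_le_of_le_one_left (h.nonneg x w) this).trans (hM w)
  have hL : ∫⁻ w in Ioo u t, survival q x u w * ENNReal.ofReal (q x w) =
      ENNReal.ofReal (∫ w in u..t, Real.exp (-∫ θ in u..w, q x θ) * q x w) := by
    rw [intervalIntegral.integral_of_le hut, integral_Ioc_eq_integral_Ioo,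
      setIntegral_congr_fun measurableSet_Ioo
        (g := fun w => Real.exp (-(qInt q x u w)) * q x w) (fun w hw => by
          simp only [hI w hw.1.le]),
      ofReal_integral_eq_lintegral_ofReal hintg (.of_forall hnn)]
    simp only [survival, ENNReal.ofReal_mul (Real.exp_pos _).le]
  rw [hL, survival, hI t hut, ← ENNReal.ofReal_add (Real.exp_pos _).le, key, ENNReal.ofReal_one]
  exact intervalIntegral.integral_nonneg_of_forall hut fun w =>
    mul_nonneg (Real.exp_pos _).le (h.nonneg x w)

theorem measurable_survival {X : Type*} [MeasurableSpace X] {q : X → ℝ → ℝ}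
    (hq : Measurable (Function.uncurry q)) {α : Type*} [MeasurableSpace α] {x : α → X}
    {u t : α → ℝ} (hx : Measurable x) (hu : Measurable u) (ht : Measurable t) :
    Measurable fun a => survival q (x a) (u a) (t a) :=
  (measurable_setIntegral_Ioo (f := fun a θ => q (x a) θ)
    (hq.comp ((hx.comp measurable_fst).prodMk measurable_snd)) hu ht).neg.exp.ennreal_ofReal

namespace IsBoundedQFunction

variable {X : Type*} [MeasurableSpace X] {q : X → ℝ → ℝ} {qp : X → ℝ → Measure X}

theorem survival_le_one (h : IsBoundedQFunction q qp) (x : X) (u t : ℝ) :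
    survival q x u t ≤ 1 := by
  have : 0 ≤ qInt q x u t := integral_nonneg fun θ => h.nonneg x θ
  exact ENNReal.ofReal_le_one.2 (Real.exp_le_one_iff.2 (by linarith))

theorem isFiniteMeasure_jump (h : IsBoundedQFunction q qp) (x : X) (t : ℝ) :
    IsFiniteMeasure (qp x t) :=
  ⟨by rw [h.jump_univ]; exact ENNReal.ofReal_lt_top⟩

/-- The jump measures of a bounded Q-function as a kernel. -/
noncomputable def jumpKernel (h : IsBoundedQFunction q qp) : Kernel (X × ℝ) X where
  toFun p := qp p.1 p.2
  measurable' := Measure.measurable_of_measurable_coe _ h.measurable_jump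

instance (h : IsBoundedQFunction q qp) : IsSFiniteKernel h.jumpKernel := by
  classical
  have hS (n : ℕ) : MeasurableSet {p : X × ℝ | ⌊q p.1 p.2⌋₊ = n} :=
    (Nat.measurable_floor.comp h.measurable_rate) (measurableSet_singleton n)
  have hfin (n : ℕ) : IsFiniteKernel (Kernel.piecewise (hS n) h.jumpKernel 0) := by
    refine ⟨ENNReal.ofReal (n + 1), ENNReal.ofReal_lt_top, fun p => ?_⟩
    rw [Kernel.piecewise_apply]
    split_ifs with hp
    · change qp p.1 p.2 univ ≤ _
      rw [h.jump_univ]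
      refine ENNReal.ofReal_le_ofReal ?_
      have := Nat.lt_floor_add_one (q p.1 p.2)
      rw [hp] at this
      exact this.le
    · simp
  refine ⟨fun n => Kernel.piecewise (hS n) h.jumpKernel 0, hfin, ?_⟩
  ext p s hs
  rw [Kernel.sum_apply' _ _ hs, tsum_eq_single ⌊q p.1 p.2⌋₊]
  · rw [Kernel.piecewise_apply, if_pos (by simp)]
  · intro n hn
    rw [Kernel.piecewise_apply, if_neg (fun hp => hn hp.symm)]
    simp

theorem measurable_lintegral_jump (h : IsBoundedQFunction q qp) {α : Type*} [MeasurableSpace α]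
    {f : α → X → ℝ≥0∞} (hf : Measurable (Function.uncurry f)) {x : α → X} {t : α → ℝ}
    (hx : Measurable x) (ht : Measurable t) :
    Measurable fun a => ∫⁻ y, f a y ∂qp (x a) (t a) :=
  hf.lintegral_kernel_prod_right (κ := h.jumpKernel.comap _ (hx.prodMk ht))

variable (q qp) in
/-- Joint measurability of the `n`-th Feller iterate. -/
def _root_.MeasurableIterate (n : ℕ) : Prop :=
  Measurable fun p : ℝ × X × ℝ => PbarM q qp n p.1 p.2.1 p.2.2

theorem _root_.MeasurableIterate.comp {n : ℕ} (hP : MeasurableIterate q qp n) {α : Type*}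
    [MeasurableSpace α] {u t : α → ℝ} {x : α → X} (hu : Measurable u) (hx : Measurable x)
    (ht : Measurable t) : Measurable fun a => PbarM q qp n (u a) (x a) (t a) :=
  Measurable.comp (g := fun p : ℝ × X × ℝ => PbarM q qp n p.1 p.2.1 p.2.2) hP
    (hu.prodMk (hx.prodMk ht))

theorem lintegral_PbarM_zero (x : X) (u t : ℝ) {g : X → ℝ≥0∞} (hg : Measurable g) :
    ∫⁻ z, g z ∂PbarM q qp 0 u x t = survival q x u t * g x := by
  rw [PbarM, lintegral_smul_measure, lintegral_dirac' _ hg]; rfl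

theorem measurable_bind_PbarM (h : IsBoundedQFunction q qp) {n : ℕ}
    (hP : MeasurableIterate q qp n) (x : X) (u t : ℝ) :
    Measurable fun v => (ENNReal.ofReal (Real.exp (-(qInt q x u v))) • qp x v).bind fun y =>
      PbarM q qp n v y t := by
  refine Measure.measurable_of_measurable_coe _ fun B hB => ?_
  have (v : ℝ) : Measurable fun y => PbarM q qp n v y t :=
    hP.comp measurable_const measurable_id measurable_const
  simp only [Measure.bind_apply hB (this _).aemeasurable, lintegral_smul_measure, smul_eq_mul]
  refine (measurable_survival h.measurable_rate measurable_const measurable_const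
    measurable_id).mul (h.measurable_lintegral_jump ?_ measurable_const measurable_id)
  exact (Measure.measurable_coe hB).comp
    (hP.comp measurable_fst measurable_snd measurable_const)

theorem lintegral_PbarM_succ_aux (h : IsBoundedQFunction q qp) {n : ℕ}
    (hP : MeasurableIterate q qp n) (x : X) (u t : ℝ) {g : X → ℝ≥0∞} (hg : Measurable g) :
    ∫⁻ z, g z ∂PbarM q qp (n + 1) u x t =
      ∫⁻ v in Ioo u t, survival q x u v * ∫⁻ y, ∫⁻ z, g z ∂PbarM q qp n v y t ∂qp x v := by
  have (v : ℝ) : Measurable fun y => PbarM q qp n v y t :=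
    hP.comp measurable_const measurable_id measurable_const
  rw [PbarM, Measure.lintegral_bind (h.measurable_bind_PbarM hP x u t).aemeasurable
    hg.aemeasurable]
  simp only [Measure.lintegral_bind (this _).aemeasurable hg.aemeasurable,
    lintegral_smul_measure, smul_eq_mul]
  rfl

theorem measurableIterate (h : IsBoundedQFunction q qp) (n : ℕ) : MeasurableIterate q qp n := by
  induction n with
  | zero =>
    refine Measure.measurable_of_measurable_coe _ fun B hB => ?_
    simp only [← lintegral_indicator_one hB,
      lintegral_PbarM_zero _ _ _ (measurable_one.indicator hB)]
    exact (measurable_survival h.measurable_rate (by fun_prop) (by fun_prop) (by fun_prop)).mul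
      ((measurable_one.indicator hB).comp (by fun_prop))
  | succ n ih =>
    refine Measure.measurable_of_measurable_coe _ fun B hB => ?_
    simp only [← lintegral_indicator_one hB,
      h.lintegral_PbarM_succ_aux ih _ _ _ (measurable_one.indicator hB)]
    refine measurable_setLIntegral_Ioo ?_ (by fun_prop) (by fun_prop)
    refine (measurable_survival h.measurable_rate (by fun_prop) (by fun_prop) (by fun_prop)).mul
      (h.measurable_lintegral_jump ?_ (by fun_prop) (by fun_prop))
    exact (Measure.measurable_lintegral (measurable_one.indicator hB)).comp
      (ih.comp (u := fun p : ((ℝ × X × ℝ) × ℝ) × X => p.1.2) (x := fun p => p.2)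
        (t := fun p => p.1.1.2.2) (by fun_prop) (by fun_prop) (by fun_prop))

theorem lintegral_PbarM_succ (h : IsBoundedQFunction q qp) (n : ℕ) (x : X) (u t : ℝ)
    {g : X → ℝ≥0∞} (hg : Measurable g) :
    ∫⁻ z, g z ∂PbarM q qp (n + 1) u x t =
      ∫⁻ v in Ioo u t, survival q x u v * ∫⁻ y, ∫⁻ z, g z ∂PbarM q qp n v y t ∂qp x v :=
  h.lintegral_PbarM_succ_aux (h.measurableIterate n) x u t hg

theorem PbarM_le_one (h : IsBoundedQFunction q qp) (n : ℕ) (u : ℝ) (x : X) (t : ℝ) :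
    PbarM q qp n u x t univ ≤ 1 := by
  induction n generalizing u x with
  | zero =>
    rw [← lintegral_one, lintegral_PbarM_zero _ _ _ measurable_const, mul_one]
    exact h.survival_le_one x u t
  | succ n ih =>
    rw [← lintegral_one, h.lintegral_PbarM_succ n x u t measurable_const]
    rcases le_or_gt u t with hut | hut
    · refine le_trans ?_ (le_add_self.trans_eq (h.survival_add_lintegral x hut))
      refine lintegral_mono fun v => mul_le_mul_right ?_ _
      rw [← h.jump_univ, ← lintegral_one]
      exact lintegral_mono fun y => by simpa using ih v y
    · simp [Ioo_eq_empty hut.not_gt]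

theorem measurable_lintegral_PbarM (h : IsBoundedQFunction q qp) (n : ℕ) {α : Type*}
    [MeasurableSpace α] {f : α → X → ℝ≥0∞} (hf : Measurable (Function.uncurry f))
    {u t : α → ℝ} {x : α → X} (hu : Measurable u) (hx : Measurable x) (ht : Measurable t) :
    Measurable fun a => ∫⁻ z, f a z ∂PbarM q qp n (u a) (x a) (t a) := by
  let κ : Kernel α X := ⟨_, (h.measurableIterate n).comp hu hx ht⟩
  have : IsFiniteKernel κ := ⟨1, ENNReal.one_lt_top, fun a => h.PbarM_le_one n _ _ _⟩
  exact hf.lintegral_kernel_prod_right (κ := κ)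

/-- First-jump decomposition of the time integral of the `(n+1)`-st iterate. -/
theorem lintegral_lintegral_PbarM_succ (h : IsBoundedQFunction q qp) (n : ℕ) (x : X) (u t : ℝ)
    {g : ℝ → X → ℝ≥0∞} (hg : Measurable (Function.uncurry g)) :
    ∫⁻ w in Ioo u t, ∫⁻ z, g w z ∂PbarM q qp (n + 1) u x w =
      ∫⁻ v in Ioo u t, survival q x u v *
        ∫⁻ y, (∫⁻ w in Ioo v t, ∫⁻ z, g w z ∂PbarM q qp n v y w) ∂qp x v := by
  have hgw (w : ℝ) : Measurable (g w) := hg.comp measurable_prodMk_left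
  have hP : Measurable fun p : (ℝ × ℝ) × X => ∫⁻ z, g p.1.2 z ∂PbarM q qp n p.1.1 p.2 p.1.2 :=
    h.measurable_lintegral_PbarM n (f := fun (p : (ℝ × ℝ) × X) z => g p.1.2 z)
      (hg.comp (f := fun p : ((ℝ × ℝ) × X) × X => (p.1.1.2, p.2)) (by fun_prop)) (by fun_prop) (by fun_prop) (by fun_prop)
  have hJ : Measurable fun p : ℝ × ℝ =>
      ∫⁻ y, ∫⁻ z, g p.2 z ∂PbarM q qp n p.1 y p.2 ∂qp x p.1 :=
    h.measurable_lintegral_jump hP measurable_const measurable_fst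
  simp only [h.lintegral_PbarM_succ n x u _ (hgw _)]
  rw [lintegral_Ioo_triangle_swap (F := fun v w => survival q x u v *
    ∫⁻ y, ∫⁻ z, g w z ∂PbarM q qp n v y w ∂qp x v)]
  · refine lintegral_congr fun v => ?_
    have hJv : Measurable fun w => ∫⁻ y, ∫⁻ z, g w z ∂PbarM q qp n v y w ∂qp x v :=
      hJ.comp measurable_prodMk_left
    rw [lintegral_const_mul _ hJv]
    have := h.isFiniteMeasure_jump x v
    congr 1
    exact lintegral_lintegral_swap (f := fun w y => ∫⁻ z, g w z ∂PbarM q qp n v y w)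
      (hP.comp (g := fun p : (ℝ × ℝ) × X => ∫⁻ z, g p.1.2 z ∂PbarM q qp n p.1.1 p.2 p.1.2)
        (f := fun p : ℝ × X => ((v, p.1), p.2)) (by fun_prop)).aemeasurable
  · exact (measurable_survival h.measurable_rate measurable_const measurable_const
      measurable_fst).mul hJ

theorem measurable_rate_indicator (h : IsBoundedQFunction q qp) {B : Set X}
    (hB : MeasurableSet B) :
    Measurable (Function.uncurry fun (w : ℝ) y =>
      B.indicator (fun y => ENNReal.ofReal (q y w)) y) :=
  ((h.measurable_rate.comp measurable_swap).ennreal_ofReal).indicator (measurable_snd hB)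

/-- Mass balance for paths without jumps. -/
theorem PbarM_zero_add_lintegral (h : IsBoundedQFunction q qp) (x : X) {u t : ℝ} (hut : u ≤ t)
    {B : Set X} (hB : MeasurableSet B) :
    PbarM q qp 0 u x t B +
        ∫⁻ w in Ioo u t, ∫⁻ y, B.indicator (fun y => ENNReal.ofReal (q y w)) y
          ∂PbarM q qp 0 u x w =
      B.indicator 1 x := by
  have hq (w : ℝ) : Measurable (B.indicator fun y => ENNReal.ofReal (q y w)) :=
    (h.measurable_rate.comp measurable_prodMk_right).ennreal_ofReal.indicator hB
  rw [← lintegral_indicator_one hB, lintegral_PbarM_zero _ _ _ (measurable_one.indicator hB)]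
  simp only [lintegral_PbarM_zero _ _ _ (hq _)]
  by_cases hx : x ∈ B
  · simpa [hx] using h.survival_add_lintegral x hut
  · simp [hx]

/-- First-jump decomposition of the mass balance of the `(n+1)`-st iterate. -/
theorem PbarM_succ_add_lintegral_eq (h : IsBoundedQFunction q qp) (n : ℕ) (x : X) (u t : ℝ)
    {B : Set X} (hB : MeasurableSet B) :
    PbarM q qp (n + 1) u x t B +
        ∫⁻ w in Ioo u t, ∫⁻ y, B.indicator (fun y => ENNReal.ofReal (q y w)) y
          ∂PbarM q qp (n + 1) u x w =
      ∫⁻ v in Ioo u t, survival q x u v * ∫⁻ y, (PbarM q qp n v y t B +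
        ∫⁻ w in Ioo v t, ∫⁻ z, B.indicator (fun z => ENNReal.ofReal (q z w)) z
          ∂PbarM q qp n v y w) ∂qp x v := by
  have h1B : Measurable (B.indicator (1 : X → ℝ≥0∞)) := measurable_one.indicator hB
  have hP0 : Measurable fun p : ℝ × X => ∫⁻ z, B.indicator 1 z ∂PbarM q qp n p.1 p.2 t :=
    h.measurable_lintegral_PbarM n (f := fun (_ : ℝ × X) z => B.indicator 1 z)
      (h1B.comp measurable_snd) measurable_fst measurable_snd measurable_const
  rw [← lintegral_indicator_one hB, h.lintegral_PbarM_succ n x u t h1B,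
    h.lintegral_lintegral_PbarM_succ n x u t (h.measurable_rate_indicator hB),
    ← lintegral_add_left]
  · refine lintegral_congr fun v => ?_
    have hPv : Measurable fun y => ∫⁻ z, B.indicator 1 z ∂PbarM q qp n v y t :=
      hP0.comp measurable_prodMk_left
    rw [← mul_add, ← lintegral_add_left hPv]
    simp only [← lintegral_indicator_one hB]
  · exact (measurable_survival h.measurable_rate measurable_const measurable_const
      measurable_id).mul (h.measurable_lintegral_jump hP0 measurable_const measurable_id)

/-- Integrated forward equation relating consecutive Feller iterates. -/
theorem PbarM_succ_add_lintegral (h : IsBoundedQFunction q qp) (n : ℕ) (x : X) (u t : ℝ)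
    {B : Set X} (hB : MeasurableSet B) :
    PbarM q qp (n + 1) u x t B +
        ∫⁻ w in Ioo u t, ∫⁻ y, B.indicator (fun y => ENNReal.ofReal (q y w)) y
          ∂PbarM q qp (n + 1) u x w =
      ∫⁻ w in Ioo u t, ∫⁻ z, qp z w B ∂PbarM q qp n u x w := by
  have hjB : Measurable (Function.uncurry fun (w : ℝ) z => qp z w B) :=
    (h.measurable_jump B hB).comp measurable_swap
  rw [h.PbarM_succ_add_lintegral_eq n x u t hB]
  induction n generalizing u x with
  | zero =>
    refine setLIntegral_congr_fun measurableSet_Ioo fun v hv => ?_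
    simp only [h.PbarM_zero_add_lintegral _ hv.2.le hB, lintegral_indicator_one hB]
    exact (lintegral_PbarM_zero (g := fun z => qp z v B) x u v
      (hjB.comp measurable_prodMk_left)).symm
  | succ n ih =>
    rw [h.lintegral_lintegral_PbarM_succ n x u t hjB]
    simp only [h.PbarM_succ_add_lintegral_eq n _ _ t hB, ih]

/-- The total mass of the Feller series is at most one. -/
theorem PbarMeas_univ_le_one (h : IsBoundedQFunction q qp) (x : X) {u t : ℝ} (hut : u ≤ t) :
    PbarMeas q qp u x t univ ≤ 1 := by
  rw [PbarMeas, Measure.sum_apply _ MeasurableSet.univ, ENNReal.tsum_eq_iSup_nat]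
  have hsum (N : ℕ) : ∑ n ∈ Finset.range (N + 1), PbarM q qp n u x t univ +
      ∫⁻ w in Ioo u t, ∫⁻ y, ENNReal.ofReal (q y w) ∂PbarM q qp N u x w = 1 := by
    induction N with
    | zero => simpa using h.PbarM_zero_add_lintegral x hut MeasurableSet.univ
    | succ N ih =>
      have := h.PbarM_succ_add_lintegral N x u t MeasurableSet.univ
      simp only [indicator_univ, h.jump_univ] at this
      rw [Finset.sum_range_succ, add_assoc, this, ih]
  refine iSup_le fun N => ?_
  refine (Finset.sum_le_sum_of_subset (Finset.range_mono N.le_succ)).trans ?_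
  exact le_self_add.trans_eq (hsum N)

theorem lintegral_PbarMeas (x : X) (u t : ℝ) (g : X → ℝ≥0∞) :
    ∫⁻ z, g z ∂PbarMeas q qp u x t = ∑' n, ∫⁻ z, g z ∂PbarM q qp n u x t :=
  lintegral_sum_measure _ _

theorem measurable_lintegral_PbarMeas (h : IsBoundedQFunction q qp) (x : X) (u : ℝ)
    {g : ℝ → X → ℝ≥0∞} (hg : Measurable (Function.uncurry g)) :
    Measurable fun w => ∫⁻ z, g w z ∂PbarMeas q qp u x w := by
  simp only [lintegral_PbarMeas]
  exact Measurable.tsum fun n => h.measurable_lintegral_PbarM n hg measurable_const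
    measurable_const measurable_id

/-- Integrated forward equation for the Feller series. -/
theorem PbarMeas_add_lintegral (h : IsBoundedQFunction q qp) (x : X) {u t : ℝ} (hut : u ≤ t)
    {B : Set X} (hB : MeasurableSet B) :
    PbarMeas q qp u x t B +
        ∫⁻ w in Ioo u t, ∫⁻ y, B.indicator (fun y => ENNReal.ofReal (q y w)) y
          ∂PbarMeas q qp u x w =
      B.indicator 1 x + ∫⁻ w in Ioo u t, ∫⁻ z, qp z w B ∂PbarMeas q qp u x w := by
  have hjB : Measurable (Function.uncurry fun (w : ℝ) z => qp z w B) :=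
    (h.measurable_jump B hB).comp measurable_swap
  have hswap {g : ℝ → X → ℝ≥0∞} (hg : Measurable (Function.uncurry g)) :
      ∫⁻ w in Ioo u t, ∫⁻ z, g w z ∂PbarMeas q qp u x w =
        ∑' n, ∫⁻ w in Ioo u t, ∫⁻ z, g w z ∂PbarM q qp n u x w := by
    simp only [lintegral_PbarMeas]
    exact lintegral_tsum fun n => (h.measurable_lintegral_PbarM n hg measurable_const
      measurable_const measurable_id).aemeasurable
  rw [hswap (h.measurable_rate_indicator hB), hswap hjB, PbarMeas, Measure.sum_apply _ hB,
    ← ENNReal.tsum_add, tsum_eq_zero_add' ENNReal.summable, h.PbarM_zero_add_lintegral x hut hB]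
  simp only [h.PbarM_succ_add_lintegral _ x u t hB]

/-- Kolmogorov's forward equation for a Q-function which is bounded in time for each state. -/
theorem forward_equation (h : IsBoundedQFunction q qp) (x : X) {u s : ℝ} {B : Set X}
    (hB : MeasurableSet B) {M : ℝ} (hM : ∀ y ∈ B, ∀ t, q y t ≤ M) :
    ∀ᵐ t ∂(volume.restrict (Ioo u s)),
      HasDerivAt (fun r => (PbarMeas q qp u x r B).toReal)
        (fkeRHS q qp (PbarMeas q qp) u x t B) t := by
  rcases le_or_gt s u with hus | hus
  · simp [Ioo_eq_empty hus.not_gt]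
  have hjB : Measurable (Function.uncurry fun (w : ℝ) z => qp z w B) :=
    (h.measurable_jump B hB).comp measurable_swap
  set a : ℝ → ℝ≥0∞ := fun w => ∫⁻ y, B.indicator (fun y => ENNReal.ofReal (q y w)) y
    ∂PbarMeas q qp u x w with ha_def
  set b : ℝ → ℝ≥0∞ := fun w => ∫⁻ z, qp z w B ∂PbarMeas q qp u x w with hb_def
  have ha : Measurable a := h.measurable_lintegral_PbarMeas x u (h.measurable_rate_indicator hB)
  have hb : Measurable b := h.measurable_lintegral_PbarMeas x u hjB
  have hbal {t : ℝ} (ht : u ≤ t) : PbarMeas q qp u x t B + ∫⁻ w in Ioo u t, a w =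
      B.indicator 1 x + ∫⁻ w in Ioo u t, b w := h.PbarMeas_add_lintegral x ht hB
  have hP1 {t : ℝ} (ht : u ≤ t) (S : Set X) : PbarMeas q qp u x t S ≤ 1 :=
    (measure_mono (subset_univ S)).trans (h.PbarMeas_univ_le_one x ht)
  have haM {w : ℝ} (hw : u ≤ w) : a w ≤ ENNReal.ofReal M := by
    calc a w ≤ ∫⁻ _, ENNReal.ofReal M ∂PbarMeas q qp u x w := lintegral_mono fun y => by
          by_cases hy : y ∈ B
          · simpa [hy] using ENNReal.ofReal_le_ofReal (hM y hy w)
          · simp [hy]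
      _ ≤ ENNReal.ofReal M := by
          rw [lintegral_const]
          exact mul_le_of_le_one_right' (hP1 hw univ)
  have hafin {t : ℝ} : ∫⁻ w in Ioo u t, a w ≠ ∞ := by
    refine ne_top_of_le_ne_top ?_ (setLIntegral_mono measurable_const fun w hw => haM hw.1.le)
    rw [setLIntegral_const]
    exact ENNReal.mul_ne_top ENNReal.ofReal_ne_top (by simp)
  have hbfin {t : ℝ} (ht : u ≤ t) : ∫⁻ w in Ioo u t, b w ≠ ∞ := by
    refine ne_top_of_le_ne_top ?_ (le_add_self.trans_eq (hbal ht).symm)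
    exact ENNReal.add_ne_top.2 ⟨ne_top_of_le_ne_top ENNReal.one_ne_top (hP1 ht B), hafin⟩
  have hint {c : ℝ → ℝ≥0∞} (hc : Measurable c) {t : ℝ} (hfin : ∫⁻ w in Ioo u t, c w ≠ ∞) :
      IntegrableOn (fun w => (c w).toReal) (Ioo u t) :=
    integrable_toReal_of_lintegral_ne_top hc.aemeasurable hfin
  have htoReal {c : ℝ → ℝ≥0∞} (hc : Measurable c) {t : ℝ} (ht : u ≤ t)
      (hfin : ∫⁻ w in Ioo u t, c w ≠ ∞) :
      (∫⁻ w in Ioo u t, c w).toReal = ∫ w in u..t, (c w).toReal := by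
    rw [intervalIntegral.integral_of_le ht, integral_Ioc_eq_integral_Ioo,
      integral_toReal hc.aemeasurable (ae_lt_top hc hfin)]
  have hii {c : ℝ → ℝ≥0∞} (hc : Measurable c) {t : ℝ} (ht : u ≤ t)
      (hfin : ∫⁻ w in Ioo u t, c w ≠ ∞) :
      IntervalIntegrable (fun w => (c w).toReal) volume u t :=
    (intervalIntegrable_iff_integrableOn_Ioo_of_le ht).2 (hint hc hfin)
  have hF {t : ℝ} (ht : u ≤ t) : (PbarMeas q qp u x t B).toReal =
      (B.indicator (1 : X → ℝ≥0∞) x).toReal - (∫ w in u..t, (a w).toReal) +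
        ∫ w in u..t, (b w).toReal := by
    have := congrArg ENNReal.toReal (hbal ht)
    rw [ENNReal.toReal_add (ne_top_of_le_ne_top ENNReal.one_ne_top (hP1 ht B)) hafin,
      ENNReal.toReal_add _ (hbfin ht), htoReal ha ht hafin, htoReal hb ht (hbfin ht)] at this
    · linarith
    · by_cases hx : x ∈ B <;> simp [hx]
  rw [ae_restrict_iff' measurableSet_Ioo]
  filter_upwards [(hii ha hus.le hafin).ae_hasDerivAt_integral,
    (hii hb hus.le (hbfin hus.le)).ae_hasDerivAt_integral] with t hta htb ht
  have htu : t ∈ uIcc u s := by rw [uIcc_of_le hus.le]; exact Ioo_subset_Icc_self ht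
  have hRHS : fkeRHS q qp (PbarMeas q qp) u x t B = -(a t).toReal + (b t).toReal := by
    have hqm : Measurable fun y => q y t := h.measurable_rate.comp measurable_prodMk_right
    have hjm : Measurable fun y => qp y t B := hjB.comp measurable_prodMk_left
    rw [fkeRHS, integral_eq_lintegral_of_nonneg_ae (.of_forall fun y => h.nonneg y t)
      hqm.aestronglyMeasurable, integral_toReal hjm.aemeasurable (.of_forall fun y => ?_)]
    · simp only [ha_def, hb_def, lintegral_indicator hB]
    · have := h.isFiniteMeasure_jump y t
      exact measure_lt_top _ _
  rw [hRHS]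
  refine (((hta htu u left_mem_uIcc).const_sub (B.indicator (1 : X → ℝ≥0∞) x).toReal).fun_add
    (htb htu u left_mem_uIcc)).congr_of_eventuallyEq ?_
  filter_upwards [Ioi_mem_nhds ht.1] with r hr
  exact hF (le_of_lt hr)

end IsBoundedQFunction

/-- The Feller iterates on `[T0,s)` depend only on the restriction of the Q-function to `[T0,s)`. -/
theorem PbarM_congr {X : Type*} [MeasurableSpace X] {q q' : X → ℝ → ℝ} {qp qp' : X → ℝ → Measure X}
    {T0 s : ℝ} (hq : ∀ x, ∀ t ∈ Ico T0 s, q x t = q' x t)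
    (hqp : ∀ x, ∀ t ∈ Ico T0 s, qp x t = qp' x t) (n : ℕ) (x : X) {u t : ℝ} (hu : T0 ≤ u)
    (ht : t < s) : PbarM q qp n u x t = PbarM q' qp' n u x t := by
  have hI {w : ℝ} (hw : w ≤ t) : qInt q x u w = qInt q' x u w :=
    setIntegral_congr_fun measurableSet_Ioo fun θ hθ =>
      hq x θ ⟨hu.trans hθ.1.le, (hθ.2.trans_le hw).trans ht⟩
  induction n generalizing u x with
  | zero => rw [PbarM, PbarM, hI le_rfl]
  | succ n ih =>
    rw [PbarM, PbarM]
    refine Measure.bind_congr_right ?_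
    filter_upwards [ae_restrict_mem measurableSet_Ioo] with w hw
    rw [hI hw.2.le, hqp x w ⟨hu.trans hw.1.le, hw.2.trans ht⟩]
    refine Measure.bind_congr_right (.of_forall fun y => ?_)
    refine ih y (hu.trans hw.1.le) fun {w'} hw' => ?_
    exact setIntegral_congr_fun measurableSet_Ioo fun θ hθ =>
      hq y θ ⟨(hu.trans hw.1.le).trans hθ.1.le, (hθ.2.trans_le hw').trans ht⟩

theorem pbar_satisfies_forward_equation
    {X : Type*} [MeasurableSpace X] [StandardBorelSpace X]
    (T0 : ℝ) (T1 : EReal) (hT0 : 0 ≤ T0) (hT01 : (T0 : EReal) < T1)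
    (q : X → ℝ → ℝ) (qp : X → ℝ → Measure X)
    (hq_nonneg : ∀ x t, T0 ≤ t → (t : EReal) < T1 → 0 ≤ q x t)
    (hq_meas : Measurable (Function.uncurry q))
    (hqp_self : ∀ x t, T0 ≤ t → (t : EReal) < T1 → qp x t {x} = 0)
    (hqp_total : ∀ x t, T0 ≤ t → (t : EReal) < T1 → qp x t Set.univ = ENNReal.ofReal (q x t))
    (hqp_meas : ∀ B : Set X, MeasurableSet B → Measurable (fun p : X × ℝ => qp p.1 p.2 B))
    (hALB : ∀ x : X, ∀ s : ℝ, T0 < s → (s : EReal) < T1 →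
      ∃ M : ℝ, ∀ t : ℝ, T0 ≤ t → t < s → q x t ≤ M)
    :
    FwdII q qp T0 T1 (PbarMeas q qp) := by
  intro u hu s hus hs x B ⟨hB, M, hM⟩
  have hlt {t : ℝ} (ht : t < s) : (t : EReal) < T1 := (EReal.coe_lt_coe_iff.2 ht).trans hs
  have hT0s : T0 < s := hu.trans_lt hus
  classical
  let q' : X → ℝ → ℝ := fun y t => if t ∈ Ico T0 s then q y t else 0
  let qp' : X → ℝ → Measure X := fun y t => if t ∈ Ico T0 s then qp y t else 0
  have hq' (y : X) (t : ℝ) (ht : t ∈ Ico T0 s) : q y t = q' y t := (if_pos ht).symm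
  have hqp' (y : X) (t : ℝ) (ht : t ∈ Ico T0 s) : qp y t = qp' y t := (if_pos ht).symm
  have hS : MeasurableSet {p : X × ℝ | p.2 ∈ Ico T0 s} := measurable_snd measurableSet_Ico
  have h : IsBoundedQFunction q' qp' :=
    { nonneg := fun y t => by
        simp only [q']
        split_ifs with ht
        · exact hq_nonneg y t ht.1 (hlt ht.2)
        · exact le_rfl
      measurable_rate := Measurable.ite hS hq_meas measurable_const
      measurable_jump := fun C hC => by
        have (p : X × ℝ) : qp' p.1 p.2 C = if p.2 ∈ Ico T0 s then qp p.1 p.2 C else 0 := by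
          simp only [qp']
          split_ifs <;> simp
        simp only [this]
        exact Measurable.ite hS (hqp_meas C hC) measurable_const
      jump_univ := fun y t => by
        simp only [q', qp']
        split_ifs with ht
        · exact hqp_total y t ht.1 (hlt ht.2)
        · simp
      bounded := fun y => by
        obtain ⟨K, hK⟩ := hALB y s hT0s hs
        refine ⟨max K 0, fun t => ?_⟩
        simp only [q']
        split_ifs with ht
        · exact (hK t ht.1 ht.2).trans (le_max_left _ _)
        · exact le_max_right _ _ }
  have hM' : ∀ y ∈ B, ∀ t, q' y t ≤ max M 0 := fun y hy t => by
    simp only [q']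
    split_ifs with ht
    · exact (hM y hy t ht.1 (EReal.coe_lt_coe_iff.2 ht.2)).trans (le_max_left _ _)
    · exact le_max_right _ _
  have hP {t : ℝ} (ht : t < s) : PbarMeas q qp u x t = PbarMeas q' qp' u x t := by
    simp only [PbarMeas, PbarM_congr hq' hqp' _ x hu ht]
  filter_upwards [h.forward_equation x (u := u) (s := s) hB hM',
    ae_restrict_mem measurableSet_Ioo] with t hd ht
  have htI : t ∈ Ico T0 s := ⟨hu.trans ht.1.le, ht.2⟩
  have hRHS : fkeRHS q qp (PbarMeas q qp) u x t B =
      fkeRHS q' qp' (PbarMeas q' qp') u x t B := by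
    simp only [fkeRHS, hP ht.2, hq' _ t htI, hqp' _ t htI]
  rw [hRHS]
  refine hd.congr_of_eventuallyEq ?_
  filter_upwards [Iio_mem_nhds ht.2] with r hr
  simp only [hP hr]
end
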